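/- arXiv:math/0306362 — 3 statements merged into one kernel-verified Lean document; each statement's English description precedes it below -/
import Mathlib

section
/- For all indices i,j,k,l,m ∈ {1,…,7}: (a) ω_{ipq}ω_{jkpq} = −4ω_{ijk} (summing over p,q), and (b) ω_{ijp}ω_{klmp} = δ_{ik}ω_{jlm} − δ_{jk}ω_{ilm} + δ_{il}ω_{jmk} − δ_{jl}ω_{imk} + δ_{im}ω_{jkl} − δ_{jm}ω_{ikl} (summing over p). -/
open scoped BigOperators

/-- The generalized Kronecker/Levi-Civita epsilon symbol on `Fin 7`. -/
noncomputable def eps (v : Fin 7 → Fin 7) : ℝ :=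
  if h : Function.Bijective v then ((Equiv.Perm.sign (Equiv.ofBijective v h) : ℤ) : ℝ) else 0

/-- The basis monomial form `e_{I 0} ∧ ⋯ ∧ e_{I (p-1)}`, given by its components. -/
noncomputable def mono {p : ℕ} (I : Fin p → Fin 7) : (Fin p → Fin 7) → ℝ :=
  fun v => Matrix.det (Matrix.of fun a b => if I a = v b then (1 : ℝ) else 0)

/-- A (componentwise) `p`-form: totally antisymmetric in its indices. -/
def IsForm {p : ℕ} (c : (Fin p → Fin 7) → ℝ) : Prop :=
  (∀ v : Fin p → Fin 7, ¬ Function.Injective v → c v = 0) ∧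
  (∀ (v : Fin p → Fin 7) (σ : Equiv.Perm (Fin p)),
    c (v ∘ σ) = ((Equiv.Perm.sign σ : ℤ) : ℝ) * c v)

/-- Wedge product of forms, in components. -/
noncomputable def wedge {p q : ℕ} (a : (Fin p → Fin 7) → ℝ) (b : (Fin q → Fin 7) → ℝ) :
    (Fin (p + q) → Fin 7) → ℝ := fun v =>
  (1 / ((Nat.factorial p : ℝ) * (Nat.factorial q : ℝ))) *
    ∑ σ : Equiv.Perm (Fin (p + q)),
      ((Equiv.Perm.sign σ : ℤ) : ℝ) *
        a (fun i => v (σ (Fin.castAdd q i))) * b (fun j => v (σ (Fin.natAdd p j)))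

/-- The Hodge star operator (standard metric and orientation on ℝ⁷), in components. -/
noncomputable def hstar {p q : ℕ} (h : p + q = 7) (a : (Fin p → Fin 7) → ℝ) :
    (Fin q → Fin 7) → ℝ := fun w =>
  (1 / (Nat.factorial p : ℝ)) *
    ∑ v : Fin p → Fin 7, a v * eps (fun i => Fin.append v w (Fin.cast h.symm i))

/-- The fundamental 3-form ω = e₁₂₄+e₂₃₅+e₃₄₆+e₄₅₇+e₅₆₁+e₆₇₂+e₇₁₃ (indices shifted to 0,…,6). -/
noncomputable def ω : (Fin 3 → Fin 7) → ℝ :=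
  mono ![0, 1, 3] + mono ![1, 2, 4] + mono ![2, 3, 5] + mono ![3, 4, 6] +
    mono ![4, 5, 0] + mono ![5, 6, 1] + mono ![6, 0, 2]

/-- The 4-form Φ = −e₃₅₆₇−e₄₆₇₁−e₅₇₁₂−e₆₁₂₃−e₇₂₃₄−e₁₃₄₅−e₂₄₅₆ (indices shifted to 0,…,6). -/
noncomputable def Φ : (Fin 4 → Fin 7) → ℝ :=
  -mono ![2, 4, 5, 6] - mono ![3, 5, 6, 0] - mono ![4, 6, 0, 1] - mono ![5, 0, 1, 2] -
    mono ![6, 1, 2, 3] - mono ![0, 2, 3, 4] - mono ![1, 3, 4, 5]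

/-- Components ω_{ijk}. -/
noncomputable def ω3 (i j k : Fin 7) : ℝ := ω ![i, j, k]

/-- Components ω_{ijkl} = Φ(e_i,e_j,e_k,e_l). -/
noncomputable def ω4 (i j k l : Fin 7) : ℝ := Φ ![i, j, k, l]

/-- Kronecker delta. -/
def δ (i j : Fin 7) : ℝ := if i = j then 1 else 0

/-- Components of a 2-form. -/
def c2 (a : (Fin 2 → Fin 7) → ℝ) (i j : Fin 7) : ℝ := a ![i, j]

/-- The operator α ↦ ⋆(α ∧ ω) on 2-forms. -/
noncomputable def Lω (a : (Fin 2 → Fin 7) → ℝ) : (Fin 2 → Fin 7) → ℝ :=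
  hstar (p := 5) (q := 2) rfl (wedge a ω)

/-- Monomial forms are invariant under simultaneous translation of all indices. -/
theorem mono_add_left {p : ℕ} (t : Fin 7) (I v : Fin p → Fin 7) :
    mono (fun a => t + I a) (fun a => t + v a) = mono I v := by
  simp [mono]

/-- `ω` is the sum of the translates of `e₁₂₄`. -/
theorem omega_eq_sum (v : Fin 3 → Fin 7) :
    ω v = ∑ t : Fin 7, mono (fun a => t + ![0, 1, 3] a) v := by
  have h (t : Fin 7) : (fun a => t + ![0, 1, 3] a) = ![t, t + 1, t + 3] := by
    ext a; fin_cases a <;> simp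
  simp only [h, Fin.sum_univ_seven]
  rfl

/-- `Φ` is minus the sum of the translates of `e₃₅₆₇`. -/
theorem phi_eq_sum (v : Fin 4 → Fin 7) :
    Φ v = -∑ t : Fin 7, mono (fun a => t + ![2, 4, 5, 6] a) v := by
  have h (t : Fin 7) :
      (fun a => t + ![2, 4, 5, 6] a) = ![t + 2, t + 4, t + 5, t + 6] := by
    ext a; fin_cases a <;> simp
  simp only [h, Fin.sum_univ_seven, neg_add]
  rfl

theorem sum_mono_translate {p : ℕ} (s : Fin 7) (I v : Fin p → Fin 7) :
    ∑ t : Fin 7, mono (fun a => t + I a) (fun a => s + v a) =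
      ∑ t : Fin 7, mono (fun a => t + I a) v := by
  rw [← Equiv.sum_comp (Equiv.addLeft s)]
  refine Finset.sum_congr rfl fun t _ => ?_
  simp only [Equiv.coe_addLeft, add_assoc]
  exact mono_add_left s (fun a => t + I a) v

theorem omega3_translate (s i j k : Fin 7) : ω3 (s + i) (s + j) (s + k) = ω3 i j k := by
  have h : ![s + i, s + j, s + k] = fun a => s + ![i, j, k] a := by
    ext a; fin_cases a <;> simp
  simp only [ω3, omega_eq_sum, h]
  exact sum_mono_translate ..

theorem omega4_translate (s i j k l : Fin 7) :
    ω4 (s + i) (s + j) (s + k) (s + l) = ω4 i j k l := by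
  have h : ![s + i, s + j, s + k, s + l] = fun a => s + ![i, j, k, l] a := by
    ext a; fin_cases a <;> simp
  simp only [ω4, phi_eq_sum, h]
  exact congrArg _ (sum_mono_translate ..)

theorem delta_translate (s i j : Fin 7) : δ (s + i) (s + j) = δ i j := by
  simp [δ]

/-- Components of `e_{ab}`, as integers. -/
def mono2Int (a b i j : Fin 7) : ℤ :=
  (if a = i then (if b = j then 1 else 0) else 0) -
    (if a = j then (if b = i then 1 else 0) else 0)

/-- Components of `e_{abc}`, as integers. -/
def mono3Int (a b c i j k : Fin 7) : ℤ :=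
  (if a = i then mono2Int b c j k else 0) - (if a = j then mono2Int b c i k else 0) +
    (if a = k then mono2Int b c i j else 0)

/-- Components of `e_{abcd}`, as integers. -/
def mono4Int (a b c d i j k l : Fin 7) : ℤ :=
  (if a = i then mono3Int b c d j k l else 0) - (if a = j then mono3Int b c d i k l else 0) +
    (if a = k then mono3Int b c d i j l else 0) - (if a = l then mono3Int b c d i j k else 0)

/-- Laplace expansion of a monomial form along its first factor. -/
theorem mono_cons {p : ℕ} (a : Fin 7) (I : Fin p → Fin 7) (v : Fin (p + 1) → Fin 7) :
    mono (Matrix.vecCons a I) v =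
      ∑ n : Fin (p + 1), (-1) ^ (n : ℕ) * (if a = v n then mono I (v ∘ n.succAbove) else 0) := by
  simp only [mono, Matrix.det_succ_row_zero]
  refine Finset.sum_congr rfl fun n _ => ?_
  rw [mul_assoc]
  congr 1
  exact (ite_mul ..).trans (by rw [one_mul, zero_mul]; rfl)

theorem mono_two (a b i j : Fin 7) : mono ![a, b] ![i, j] = mono2Int a b i j := by
  simp [mono, mono2Int, Matrix.det_fin_two]
  grind

theorem mono_three (a b c i j k : Fin 7) :
    mono ![a, b, c] ![i, j, k] = mono3Int a b c i j k := by
  have h₀ : ![i, j, k] ∘ Fin.succAbove 0 = ![j, k] := by ext n; fin_cases n <;> rfl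
  have h₁ : ![i, j, k] ∘ Fin.succAbove 1 = ![i, k] := by ext n; fin_cases n <;> rfl
  have h₂ : ![i, j, k] ∘ Fin.succAbove 2 = ![i, j] := by ext n; fin_cases n <;> rfl
  rw [mono_cons, Fin.sum_univ_three, h₀, h₁, h₂]
  simp [mono3Int, mono_two, sub_eq_add_neg, apply_ite Neg.neg]

theorem mono_four (a b c d i j k l : Fin 7) :
    mono ![a, b, c, d] ![i, j, k, l] = mono4Int a b c d i j k l := by
  have h₀ : ![i, j, k, l] ∘ Fin.succAbove 0 = ![j, k, l] := by ext n; fin_cases n <;> rfl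
  have h₁ : ![i, j, k, l] ∘ Fin.succAbove 1 = ![i, k, l] := by ext n; fin_cases n <;> rfl
  have h₂ : ![i, j, k, l] ∘ Fin.succAbove 2 = ![i, j, l] := by ext n; fin_cases n <;> rfl
  have h₃ : ![i, j, k, l] ∘ Fin.succAbove 3 = ![i, j, k] := by ext n; fin_cases n <;> rfl
  rw [mono_cons, Fin.sum_univ_four, h₀, h₁, h₂, h₃]
  simp [mono4Int, mono_three, sub_eq_add_neg, pow_succ, apply_ite Neg.neg]

/-- The components `ω_{ijk}` as integers. -/
def omega3Int (i j k : Fin 7) : ℤ :=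
  mono3Int 0 1 3 i j k + mono3Int 1 2 4 i j k + mono3Int 2 3 5 i j k + mono3Int 3 4 6 i j k +
    mono3Int 4 5 0 i j k + mono3Int 5 6 1 i j k + mono3Int 6 0 2 i j k

/-- The components `ω_{ijkl}` as integers. -/
def omega4Int (i j k l : Fin 7) : ℤ :=
  -mono4Int 2 4 5 6 i j k l - mono4Int 3 5 6 0 i j k l - mono4Int 4 6 0 1 i j k l -
    mono4Int 5 0 1 2 i j k l - mono4Int 6 1 2 3 i j k l - mono4Int 0 2 3 4 i j k l -
    mono4Int 1 3 4 5 i j k l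

theorem omega3_eq_intCast (i j k : Fin 7) : ω3 i j k = omega3Int i j k := by
  simp [ω3, ω, omega3Int, mono_three]

theorem omega4_eq_intCast (i j k l : Fin 7) : ω4 i j k l = omega4Int i j k l := by
  simp [ω4, Φ, omega4Int, mono_four]

/-- Integer multiplication that skips its second factor when the first one vanishes, which keeps
kernel evaluation of sparse contractions short. -/
def sparseMul (a b : ℤ) : ℤ := if a = 0 then 0 else a * b

theorem sparseMul_eq_mul (a b : ℤ) : sparseMul a b = a * b := by
  grind [sparseMul]

theorem omega3Int_contract_omega4Int_zero : ∀ j k l m : Fin 7,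
    sparseMul (omega3Int 0 j 0) (omega4Int k l m 0) +
      sparseMul (omega3Int 0 j 1) (omega4Int k l m 1) +
      sparseMul (omega3Int 0 j 2) (omega4Int k l m 2) +
      sparseMul (omega3Int 0 j 3) (omega4Int k l m 3) +
      sparseMul (omega3Int 0 j 4) (omega4Int k l m 4) +
      sparseMul (omega3Int 0 j 5) (omega4Int k l m 5) +
      sparseMul (omega3Int 0 j 6) (omega4Int k l m 6) =
    (if 0 = k then omega3Int j l m else 0) - (if j = k then omega3Int 0 l m else 0) +
      (if 0 = l then omega3Int j m k else 0) - (if j = l then omega3Int 0 m k else 0) +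
      (if 0 = m then omega3Int j k l else 0) - (if j = m then omega3Int 0 k l else 0) := by
  decide +kernel

theorem omega3_contract_omega4 (i j k l m : Fin 7) :
    (∑ p : Fin 7, ω3 i j p * ω4 k l m p) =
      δ i k * ω3 j l m - δ j k * ω3 i l m + δ i l * ω3 j m k -
        δ j l * ω3 i m k + δ i m * ω3 j k l - δ j m * ω3 i k l := by
  wlog hi : i = 0 generalizing i j k l m
  · have h := this 0 (-i + j) (-i + k) (-i + l) (-i + m) rfl
    rw [← Equiv.sum_comp (Equiv.addLeft (-i))] at h
    simpa only [Equiv.coe_addLeft, ← neg_add_cancel i, omega3_translate, omega4_translate,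
      delta_translate] using h
  subst hi
  have h := congrArg (Int.cast (R := ℝ)) (omega3Int_contract_omega4Int_zero j k l m)
  simp only [sparseMul_eq_mul] at h
  simp only [Fin.sum_univ_seven, omega3_eq_intCast, omega4_eq_intCast, δ, ite_mul, one_mul,
    zero_mul]
  exact_mod_cast h

theorem omega3_rotate (i j k : Fin 7) : ω3 j k i = ω3 i j k := by
  have h : ∀ i j k, omega3Int j k i = omega3Int i j k := by decide +kernel
  simp only [omega3_eq_intCast, h i j k]

theorem omega3_swap (i j k : Fin 7) : ω3 j i k = -ω3 i j k := by
  have h : ∀ i j k, omega3Int j i k = -omega3Int i j k := by decide +kernel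
  simp only [omega3_eq_intCast, h i j k, Int.cast_neg]

theorem omega3_self_left (i j : Fin 7) : ω3 i i j = 0 :=
  self_eq_neg.mp (omega3_swap i i j)

/-- ω_{ipq}ω_{jkpq} = −4ω_{ijk} and
ω_{ijp}ω_{klmp} = δ_{ik}ω_{jlm} − δ_{jk}ω_{ilm} + δ_{il}ω_{jmk} − δ_{jl}ω_{imk} + δ_{im}ω_{jkl} − δ_{jm}ω_{ikl}. -/
theorem omega_contractions_two (i j k l m : Fin 7) :
    (∑ p : Fin 7, ∑ q : Fin 7, ω3 i p q * ω4 j k p q) = -4 * ω3 i j k ∧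
    (∑ p : Fin 7, ω3 i j p * ω4 k l m p) =
      δ i k * ω3 j l m - δ j k * ω3 i l m + δ i l * ω3 j m k -
        δ j l * ω3 i m k + δ i m * ω3 j k l - δ j m * ω3 i k l := by
  refine ⟨?_, omega3_contract_omega4 i j k l m⟩
  have hd : ∑ p : Fin 7, δ p p = 7 := by simp [δ]
  have h₁ (p : Fin 7) : ω3 p k p = 0 := by rw [← omega3_rotate, ← omega3_rotate, omega3_self_left]
  have h₂ : ω3 i k j = -ω3 i j k := by rw [← omega3_rotate, omega3_swap, ← omega3_rotate i j k]
  simp only [omega3_contract_omega4, h₁, omega3_self_left, mul_zero, Finset.sum_add_distrib,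
    Finset.sum_sub_distrib, ← Finset.sum_mul, hd]
  simp only [δ, ite_mul, one_mul, zero_mul, Finset.sum_ite_eq, Finset.sum_ite_eq',
    Finset.mem_univ, if_true, Finset.sum_const_zero, h₂]
  ring
end

section
/- For all indices i,j,k,l ∈ {1,…,7}: ω_{ijpq}ω_{klpq} = −2ω_{ijkl} + 4(δ_{ik}δ_{jl} − δ_{il}δ_{jk}) (summing over p,q). -/
open scoped BigOperators

/-- Integer components of a basis monomial form, by expansion along the first factor. -/
def monoInt : {p : ℕ} → (Fin p → Fin 7) → (Fin p → Fin 7) → ℤ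
  | 0, _, _ => 1
  | _ + 1, I, v => ∑ b, if I 0 = v b then
      (-1) ^ (b : ℕ) * monoInt (fun a => I a.succ) (fun c => v (b.succAbove c)) else 0

theorem mono_eq_monoInt {p : ℕ} (I v : Fin p → Fin 7) : mono I v = monoInt I v := by
  induction p with
  | zero => simp [mono, monoInt]
  | succ p ih =>
    rw [mono, Matrix.det_succ_row_zero, monoInt, Int.cast_sum]
    refine Finset.sum_congr rfl fun b _ => ?_
    have h := ih (fun a => I a.succ) (fun c => v (b.succAbove c))
    by_cases hb : I 0 = v b
    · simp [hb, ← h, mono, Matrix.submatrix]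
    · simp [hb]

/-- Integer components of `Φ`. -/
def phiInt (v : Fin 4 → Fin 7) : ℤ :=
  -monoInt ![2, 4, 5, 6] v - monoInt ![3, 5, 6, 0] v - monoInt ![4, 6, 0, 1] v -
    monoInt ![5, 0, 1, 2] v - monoInt ![6, 1, 2, 3] v - monoInt ![0, 2, 3, 4] v -
    monoInt ![1, 3, 4, 5] v

theorem monoInt_add_right {p : ℕ} (I v : Fin p → Fin 7) (c : Fin 7) :
    monoInt (fun a => I a + c) (fun a => v a + c) = monoInt I v := by
  induction p with
  | zero => rfl
  | succ p ih => simp only [monoInt, add_left_inj, ih (fun a => I a.succ)]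

theorem phiInt_add_one (v : Fin 4 → Fin 7) : phiInt (fun a => v a + 1) = phiInt v := by
  have shift (i j k l : Fin 7) :
      monoInt ![i + 1, j + 1, k + 1, l + 1] (fun a => v a + 1) = monoInt ![i, j, k, l] v := by
    rw [← monoInt_add_right ![i, j, k, l] v 1]
    congr 1
    ext a
    fin_cases a <;> rfl
  have h₀ := shift 2 4 5 6
  have h₁ := shift 3 5 6 0
  have h₂ := shift 4 6 0 1
  have h₃ := shift 5 0 1 2
  have h₄ := shift 6 1 2 3
  have h₅ := shift 0 2 3 4
  have h₆ := shift 1 3 4 5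
  simp only [Fin.reduceAdd, zero_add] at h₀ h₁ h₂ h₃ h₄ h₅ h₆
  simp only [phiInt]
  linarith

theorem phiInt_add_right (v : Fin 4 → Fin 7) (c : Fin 7) :
    phiInt (fun a => v a + c) = phiInt v := by
  induction c using Fin.induction with
  | zero => simp
  | succ c ih =>
    rw [← ih, ← phiInt_add_one fun a => v a + c.castSucc]
    simp only [add_assoc, Fin.coeSucc_eq_succ]

theorem Φ_eq_phiInt (v : Fin 4 → Fin 7) : Φ v = phiInt v := by
  simp [Φ, phiInt, mono_eq_monoInt]

/-- Components of the cross product: `e_i × e_j = ∑ k, crossInt i j k • e_k`. -/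
def crossInt (i j k : Fin 7) : ℤ :=
  let d := j - i
  if d = 1 ∨ d = 2 ∨ d = 4 then if k = i + 3 * d then 1 else 0
  else if d = 3 ∨ d = 5 ∨ d = 6 then if k = i + 5 * d then -1 else 0
  else 0

theorem crossInt_add_right (i j k c : Fin 7) :
    crossInt (i + c) (j + c) (k + c) = crossInt i j k := by
  simp only [crossInt, add_sub_add_right_eq_sub, add_right_comm i c, add_left_inj]

theorem crossInt_swap (i j k : Fin 7) : crossInt j i k = -crossInt i j k := by
  decide +revert +kernel

theorem sum_crossInt_mul_crossInt (r s : Fin 7) :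
    ∑ p, ∑ q, crossInt p q r * crossInt p q s = if r = s then 6 else 0 := by
  decide +revert +kernel

/-- The inner product of `e_i × e_j` and `e_k × e_l`. -/
def crossInner (i j k l : Fin 7) : ℤ :=
  ∑ r, crossInt i j r * crossInt k l r

/-- The inner product of the bivectors `e_{ij}` and `e_{kl}`. -/
def bivectorInner (i j k l : Fin 7) : ℤ :=
  (if i = k then if j = l then 1 else 0 else 0) -
    if i = l then if j = k then 1 else 0 else 0

theorem crossInner_add_right (i j k l c : Fin 7) :
    crossInner (i + c) (j + c) (k + c) (l + c) = crossInner i j k l := by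
  rw [crossInner, ← Equiv.sum_comp (Equiv.addRight c)]
  simp only [Equiv.coe_addRight, crossInt_add_right, crossInner]

theorem phiInt_zero_eq_bivectorInner_sub_crossInner (j k l : Fin 7) :
    phiInt ![0, j, k, l] = bivectorInner 0 j k l - crossInner 0 j k l := by
  decide +revert +kernel

theorem phiInt_eq_bivectorInner_sub_crossInner (i j k l : Fin 7) :
    phiInt ![i, j, k, l] = bivectorInner i j k l - crossInner i j k l := by
  have h := phiInt_zero_eq_bivectorInner_sub_crossInner (j - i) (k - i) (l - i)
  have hv : (fun a => ![0, j - i, k - i, l - i] a + i) = ![i, j, k, l] := by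
    ext a
    fin_cases a <;> simp
  have hB : bivectorInner 0 (j - i) (k - i) (l - i) = bivectorInner i j k l := by
    simp [bivectorInner, eq_comm, sub_eq_zero]
  rw [← phiInt_add_right _ i, hv, hB, ← crossInner_add_right _ _ _ _ i] at h
  simpa using h

theorem crossInner_comm (i j k l : Fin 7) : crossInner i j k l = crossInner k l i j := by
  simp only [crossInner, mul_comm]

theorem crossInner_swap_right (i j k l : Fin 7) :
    crossInner i j l k = -crossInner i j k l := by
  simp only [crossInner, crossInt_swap k l, mul_neg, Finset.sum_neg_distrib]

theorem bivectorInner_swap_right (i j k l : Fin 7) :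
    bivectorInner i j l k = -bivectorInner i j k l := by
  simp only [bivectorInner]
  ring

theorem sum_bivectorInner_mul (i j : Fin 7) (f : Fin 7 → Fin 7 → ℤ) :
    ∑ p, ∑ q, bivectorInner i j p q * f p q = f i j - f j i := by
  simp [bivectorInner, sub_mul, Finset.sum_sub_distrib, ite_mul]

theorem sum_crossInner_mul_crossInner (i j k l : Fin 7) :
    ∑ p, ∑ q, crossInner i j p q * crossInner k l p q = 6 * crossInner i j k l := by
  calc
    _ = ∑ r, ∑ s, crossInt i j r * crossInt k l s *
        ∑ p, ∑ q, crossInt p q r * crossInt p q s := by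
      simp only [crossInner, Finset.sum_mul_sum]
      simp only [Finset.mul_sum]
      rw [Finset.sum_congr rfl fun p _ => Finset.sum_comm, Finset.sum_comm]
      refine Finset.sum_congr rfl fun r _ => ?_
      rw [Finset.sum_congr rfl fun p _ => Finset.sum_comm, Finset.sum_comm]
      refine Finset.sum_congr rfl fun s _ => Finset.sum_congr rfl fun p _ =>
        Finset.sum_congr rfl fun q _ => by ring
    _ = _ := by
      simp [sum_crossInt_mul_crossInt, crossInner, Finset.mul_sum, mul_comm]

theorem sum_phiInt_mul_phiInt (i j k l : Fin 7) :
    ∑ p, ∑ q, phiInt ![i, j, p, q] * phiInt ![k, l, p, q] =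
      -2 * phiInt ![i, j, k, l] + 4 * bivectorInner i j k l := by
  have hBB := sum_bivectorInner_mul i j (bivectorInner k l)
  have hBC := sum_bivectorInner_mul i j (crossInner k l)
  have hCB := sum_bivectorInner_mul k l (crossInner i j)
  have hCC := sum_crossInner_mul_crossInner i j k l
  have hB : bivectorInner k l i j = bivectorInner i j k l := by
    simp only [bivectorInner, eq_comm]
    grind
  rw [bivectorInner_swap_right k l i j, hB] at hBB
  rw [crossInner_swap_right k l i j, crossInner_comm k l i j] at hBC
  rw [crossInner_swap_right i j k l] at hCB
  simp only [phiInt_eq_bivectorInner_sub_crossInner, sub_mul, mul_sub, Finset.sum_sub_distrib,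
    mul_comm (crossInner i j _ _) (bivectorInner k l _ _)]
  linarith

/-- ω_{ijpq}ω_{klpq} = −2ω_{ijkl} + 4(δ_{ik}δ_{jl} − δ_{il}δ_{jk}). -/
theorem omega_contractions_three (i j k l : Fin 7) :
    (∑ p : Fin 7, ∑ q : Fin 7, ω4 i j p q * ω4 k l p q) =
      -2 * ω4 i j k l + 4 * (δ i k * δ j l - δ i l * δ j k) := by
  have hδ : δ i k * δ j l - δ i l * δ j k = bivectorInner i j k l := by
    simp only [δ, bivectorInner]
    split_ifs <;> simp
  simp only [ω4, Φ_eq_phiInt, hδ]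
  exact_mod_cast sum_phiInt_mul_phiInt i j k l
end

section
/- Every 3-form σ on ℝ⁷ can be written uniquely as σ = t·ω + ⋆(β∧ω) + γ, where t ∈ ℝ, β is a 1-form, and γ is a 3-form satisfying γ∧ω = 0 and γ∧Φ = 0. -/
open scoped BigOperators

section Alternating

variable {p q r : ℕ}

theorem eps_comp (v : Fin 7 → Fin 7) (σ : Equiv.Perm (Fin 7)) :
    eps (v ∘ σ) = ((Equiv.Perm.sign σ : ℤ) : ℝ) * eps v := by
  unfold eps
  by_cases h : Function.Bijective v
  · have h' : Function.Bijective (v ∘ σ) := h.comp σ.bijective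
    have e : Equiv.ofBijective (v ∘ σ) h' = Equiv.ofBijective v h * σ := by ext; rfl
    rw [dif_pos h, dif_pos h', e, Equiv.Perm.sign_mul]
    push_cast
    ring
  · rw [dif_neg h, dif_neg (h ∘ (Function.Bijective.of_comp_iff v σ.bijective).mp), mul_zero]

theorem sign_mul_self_cast {n : ℕ} (σ : Equiv.Perm (Fin n)) :
    ((Equiv.Perm.sign σ : ℤ) : ℝ) * ((Equiv.Perm.sign σ : ℤ) : ℝ) = 1 := by
  rcases Int.units_eq_one_or (Equiv.Perm.sign σ) with h | h <;> simp [h]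

theorem isForm_of_comp {c : (Fin p → Fin 7) → ℝ}
    (h : ∀ (v : Fin p → Fin 7) (σ : Equiv.Perm (Fin p)),
      c (v ∘ σ) = ((Equiv.Perm.sign σ : ℤ) : ℝ) * c v) : IsForm c := by
  refine ⟨fun v hv => ?_, h⟩
  simp only [Function.Injective, not_forall] at hv
  obtain ⟨i, j, hij, hne⟩ := hv
  have e : v ∘ Equiv.swap i j = v := by
    funext k
    rcases eq_or_ne k i with rfl | hi
    · simp [hij]
    rcases eq_or_ne k j with rfl | hj
    · simp [hij]
    simp [Equiv.swap_apply_of_ne_of_ne hi hj]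
  have := h v (Equiv.swap i j)
  rw [e, Equiv.Perm.sign_swap hne] at this
  push_cast at this
  linarith

theorem IsForm.add {a b : (Fin p → Fin 7) → ℝ} (ha : IsForm a) (hb : IsForm b) :
    IsForm (a + b) :=
  isForm_of_comp fun v σ => by simp only [Pi.add_apply, ha.2, hb.2]; ring

theorem IsForm.neg {a : (Fin p → Fin 7) → ℝ} (ha : IsForm a) : IsForm (-a) :=
  isForm_of_comp fun v σ => by simp only [Pi.neg_apply, ha.2]; ring

theorem IsForm.sub {a b : (Fin p → Fin 7) → ℝ} (ha : IsForm a) (hb : IsForm b) :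
    IsForm (a - b) := sub_eq_add_neg a b ▸ ha.add hb.neg

theorem IsForm.smul {a : (Fin p → Fin 7) → ℝ} (t : ℝ) (ha : IsForm a) : IsForm (t • a) :=
  isForm_of_comp fun v σ => by simp only [Pi.smul_apply, smul_eq_mul, ha.2]; ring

theorem mono_eq_sum (I v : Fin p → Fin 7) :
    mono I v = ∑ σ : Equiv.Perm (Fin p),
      ((Equiv.Perm.sign σ : ℤ) : ℝ) * if I ∘ σ = v then 1 else 0 := by
  rw [mono, Matrix.det_apply']
  refine Finset.sum_congr rfl fun σ _ => ?_
  simp only [Matrix.of_apply, Finset.prod_boole, Finset.mem_univ, true_imp_iff, funext_iff,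
    Function.comp_apply]

theorem isForm_mono (I : Fin p → Fin 7) : IsForm (mono I) :=
  isForm_of_comp fun v σ => Matrix.det_permute' σ (Matrix.of fun a b => if I a = v b then (1 : ℝ) else 0)

/-- Pairing an alternating tensor with a monomial evaluates it at that monomial. -/
theorem IsForm.sum_mono_mul {g : (Fin p → Fin 7) → ℝ} (hg : IsForm g) (I : Fin p → Fin 7) :
    ∑ v, mono I v * g v = (Nat.factorial p : ℝ) * g I := by
  simp only [mono_eq_sum, Finset.sum_mul]
  rw [Finset.sum_comm]
  have (σ : Equiv.Perm (Fin p)) : ∑ v, (((Equiv.Perm.sign σ : ℤ) : ℝ) *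
      (if I ∘ σ = v then 1 else 0)) * g v = g I := by
    simp [hg.2, ← mul_assoc, sign_mul_self_cast]
  rw [Finset.sum_congr rfl fun σ _ => this σ]
  simp [Fintype.card_perm]

theorem mono_self {I : Fin p → Fin 7} (hI : Function.Injective I) : mono I I = 1 := by
  have : (Matrix.of fun a b => if I a = I b then (1 : ℝ) else 0) = 1 := by
    ext a b
    simp [Matrix.one_apply, hI.eq_iff]
  rw [mono, this, Matrix.det_one]

theorem wedge_isForm (a : (Fin p → Fin 7) → ℝ) (b : (Fin q → Fin 7) → ℝ) :
    IsForm (wedge a b) := by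
  refine isForm_of_comp fun v τ => ?_
  simp only [wedge]
  rw [mul_left_comm]
  congr 1
  rw [Finset.mul_sum]
  refine Fintype.sum_equiv (Equiv.mulLeft τ) _ _ fun σ => ?_
  simp only [Equiv.coe_mulLeft, Equiv.Perm.sign_mul, Equiv.Perm.mul_apply, Function.comp_apply,
    Units.val_mul, Int.cast_mul]
  simp only [← mul_assoc, sign_mul_self_cast, one_mul]

/-- The components of the volume form with the last `q` slots filled are alternating. -/
theorem isForm_eps_append (h : p + q = 7) (w : Fin q → Fin 7) :
    IsForm fun v : Fin p → Fin 7 => eps fun i => Fin.append v w (Fin.cast h.symm i) := by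
  refine isForm_of_comp fun v σ => ?_
  let τ : Equiv.Perm (Fin 7) :=
    (finSumFinEquiv.trans (finCongr h)).permCongr (Equiv.sumCongr σ (Equiv.refl (Fin q)))
  have hτ : Equiv.Perm.sign τ = Equiv.Perm.sign σ := by
    rw [Equiv.Perm.sign_permCongr]
    exact (Equiv.Perm.sign_sumCongr σ 1).trans (by simp)
  rw [← hτ, ← eps_comp]
  congr 1
  funext i
  obtain ⟨k, rfl⟩ := (finSumFinEquiv.trans (finCongr h)).surjective i
  rcases k with k | k <;> simp [τ, Equiv.permCongr_apply]

theorem isForm_append_eps (h : p + q = 7) (v : Fin p → Fin 7) :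
    IsForm fun w : Fin q → Fin 7 => eps fun i => Fin.append v w (Fin.cast h.symm i) := by
  refine isForm_of_comp fun w σ => ?_
  let τ : Equiv.Perm (Fin 7) :=
    (finSumFinEquiv.trans (finCongr h)).permCongr (Equiv.sumCongr (Equiv.refl (Fin p)) σ)
  have hτ : Equiv.Perm.sign τ = Equiv.Perm.sign σ := by
    rw [Equiv.Perm.sign_permCongr]
    exact (Equiv.Perm.sign_sumCongr 1 σ).trans (by simp)
  rw [← hτ, ← eps_comp]
  congr 1
  funext i
  obtain ⟨k, rfl⟩ := (finSumFinEquiv.trans (finCongr h)).surjective i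
  rcases k with k | k <;> simp [τ, Equiv.permCongr_apply]

theorem isForm_eps_append_append (h : p + q + r = 7) (v : Fin p → Fin 7) (w : Fin r → Fin 7) :
    IsForm fun y : Fin q → Fin 7 =>
      eps fun i => Fin.append (Fin.append v y) w (Fin.cast h.symm i) := by
  refine isForm_of_comp fun y σ => ?_
  let τ : Equiv.Perm (Fin (p + q)) :=
    finSumFinEquiv.permCongr (Equiv.sumCongr (Equiv.refl (Fin p)) σ)
  have hτ : Equiv.Perm.sign τ = Equiv.Perm.sign σ := by
    rw [Equiv.Perm.sign_permCongr]
    exact (Equiv.Perm.sign_sumCongr 1 σ).trans (by simp)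
  have e : Fin.append v (y ∘ σ) = Fin.append v y ∘ τ := by
    funext i
    obtain ⟨k, rfl⟩ := finSumFinEquiv.surjective i
    rcases k with k | k <;> simp [τ, Equiv.permCongr_apply]
  rw [← hτ, ← (isForm_eps_append h w).2 _ τ, e]

theorem isForm_hstar (h : p + q = 7) (a : (Fin p → Fin 7) → ℝ) : IsForm (hstar h a) := by
  refine isForm_of_comp fun w σ => ?_
  simp only [hstar]
  rw [mul_left_comm]
  congr 1
  rw [Finset.mul_sum]
  refine Finset.sum_congr rfl fun v _ => ?_
  exact (congrArg (a v * ·) ((isForm_append_eps h v).2 w σ)).trans (mul_left_comm _ _ _)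

theorem hstar_wedge (h : p + q + r = 7) (a : (Fin p → Fin 7) → ℝ) (b : (Fin q → Fin 7) → ℝ)
    (w : Fin r → Fin 7) :
    hstar h (wedge a b) w = 1 / ((Nat.factorial p : ℝ) * (Nat.factorial q : ℝ)) *
      ∑ x, a x * ∑ y, b y *
        eps fun i => Fin.append (Fin.append x y) w (Fin.cast h.symm i) := by
  set E : (Fin (p + q) → Fin 7) → ℝ :=
    fun v => eps fun i => Fin.append v w (Fin.cast h.symm i)
  have hEf : IsForm E := isForm_eps_append h w
  let S : ℝ := ∑ v : Fin (p + q) → Fin 7,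
    a (fun i => v (Fin.castAdd q i)) * b (fun j => v (Fin.natAdd p j)) * E v
  have hS (σ : Equiv.Perm (Fin (p + q))) :
      ∑ v : Fin (p + q) → Fin 7, ((Equiv.Perm.sign σ : ℤ) : ℝ) *
        a (fun i => v (σ (Fin.castAdd q i))) * b (fun j => v (σ (Fin.natAdd p j))) * E v = S := by
    refine Fintype.sum_equiv (σ.symm.arrowCongr (Equiv.refl (Fin 7))) _ _ fun v => ?_
    have e : σ.symm.arrowCongr (Equiv.refl (Fin 7)) v = v ∘ σ := by funext i; simp
    rw [e, hEf.2]
    simp only [Function.comp_apply]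
    ring
  have hS' : S = ∑ x, a x * ∑ y, b y * E (Fin.append x y) := by
    simp only [Finset.mul_sum]
    rw [← Fintype.sum_prod_type' (f := fun x y => a x * (b y * E (Fin.append x y)))]
    refine (Fintype.sum_equiv (Fin.appendEquiv p q) _ _ fun x => ?_).symm
    simp [Fin.appendEquiv, mul_assoc]
  rw [← hS', hstar]
  simp only [wedge, Finset.mul_sum, Finset.sum_mul]
  rw [Finset.sum_comm]
  have (σ : Equiv.Perm (Fin (p + q))) : ∑ v : Fin (p + q) → Fin 7,
      1 / (Nat.factorial (p + q) : ℝ) * (1 / ((Nat.factorial p : ℝ) * (Nat.factorial q : ℝ)) *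
        (((Equiv.Perm.sign σ : ℤ) : ℝ) * a (fun i => v (σ (Fin.castAdd q i))) *
          b (fun j => v (σ (Fin.natAdd p j)))) * E v) =
      1 / (Nat.factorial (p + q) : ℝ) *
        (1 / ((Nat.factorial p : ℝ) * (Nat.factorial q : ℝ)) * S) := by
    rw [← hS σ, Finset.mul_sum, Finset.mul_sum]
    exact Finset.sum_congr rfl fun v _ => by ring
  have hp := Nat.cast_ne_zero (R := ℝ).mpr (Nat.factorial_ne_zero (p + q))
  rw [Finset.sum_congr rfl fun σ _ => this σ, Finset.sum_const, Finset.card_univ,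
    Fintype.card_perm, Fintype.card_fin, nsmul_eq_mul, ← mul_assoc, mul_one_div_cancel hp, one_mul]

theorem exists_append_bijective (h : p + q = 7) {v : Fin p → Fin 7} (hv : Function.Injective v) :
    ∃ w : Fin q → Fin 7,
      Function.Bijective fun i : Fin 7 => Fin.append v w (Fin.cast h.symm i) := by
  have hc : (Finset.univ.image v)ᶜ.card = q := by
    rw [Finset.card_compl, Finset.card_image_of_injective _ hv]
    simp only [Fintype.card_fin, Finset.card_univ]
    omega
  refine ⟨Finset.orderEmbOfFin _ hc, Finite.injective_iff_bijective.mp ?_⟩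
  refine Function.Injective.comp (Fin.append_injective_iff.mpr
    ⟨hv, (Finset.orderEmbOfFin _ hc).injective, fun i j hij => ?_⟩) (Fin.cast_injective h.symm)
  have := Finset.orderEmbOfFin_mem _ hc j
  rw [← hij] at this
  simp at this

theorem eps_append_eq_mul_mono (h : p + q = 7) {v : Fin p → Fin 7} {w : Fin q → Fin 7}
    (hvw : Function.Bijective fun i : Fin 7 => Fin.append v w (Fin.cast h.symm i))
    (u : Fin p → Fin 7) :
    (eps fun i => Fin.append u w (Fin.cast h.symm i)) =
      (eps fun i => Fin.append v w (Fin.cast h.symm i)) * mono v u := by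
  have inj {x : Fin p → Fin 7}
      (hx : Function.Bijective fun i : Fin 7 => Fin.append x w (Fin.cast h.symm i)) :
      Function.Bijective (Fin.append x w) :=
    (Function.Bijective.of_comp_iff (Fin.append x w) (finCongr h.symm).bijective).mp hx
  have key {x y : Fin p → Fin 7} (hx : Function.Bijective (Fin.append x w))
      (hy : Function.Bijective (Fin.append y w)) (i : Fin p) : ∃ j, y j = x i := by
    obtain ⟨j, hj⟩ := hy.2 (x i)
    induction j using Fin.addCases with
    | left j => exact ⟨j, by simpa using hj⟩
    | right j =>
      rw [Fin.append_right] at hj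
      exact absurd hj.symm ((Fin.append_injective_iff.mp hx.1).2.2 i j)
  have hv := (Fin.append_injective_iff.mp (inj hvw).1).1
  by_cases hu : ∃ σ : Equiv.Perm (Fin p), v ∘ σ = u
  · obtain ⟨σ, rfl⟩ := hu
    rw [(isForm_mono v).2, mono_self hv, mul_one, mul_comm]
    exact (isForm_eps_append h w).2 v σ
  · have h0 : mono v u = 0 := by
      rw [mono_eq_sum]
      exact Finset.sum_eq_zero fun σ _ => by rw [if_neg fun e => hu ⟨σ, e⟩, mul_zero]
    rw [h0, mul_zero, eps, dif_neg]
    intro hb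
    choose f hf using key (inj hb) (inj hvw)
    have hfi : Function.Injective f := fun i j hij =>
      (Fin.append_injective_iff.mp (inj hb).1).1 (by rw [← hf i, ← hf j, hij])
    exact hu ⟨Equiv.ofBijective f (Finite.injective_iff_bijective.mp hfi), funext hf⟩

theorem IsForm.eq_zero_of_hstar {c : (Fin p → Fin 7) → ℝ} (hc : IsForm c) (h : p + q = 7)
    (h0 : ∀ w, hstar h c w = 0) : c = 0 := by
  funext v
  by_cases hv : Function.Injective v
  · obtain ⟨w, hw⟩ := exists_append_bijective h hv
    have h1 := h0 w
    have hp := Nat.cast_ne_zero (R := ℝ).mpr (Nat.factorial_ne_zero p)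
    have he : (eps fun i => Fin.append v w (Fin.cast h.symm i)) ≠ 0 := by
      rw [eps, dif_pos hw]
      exact Int.cast_ne_zero.mpr (Units.ne_zero _)
    rw [hstar, Finset.sum_congr rfl fun u _ =>
      congrArg (c u * ·) (eps_append_eq_mul_mono h hw u)] at h1
    have h2 : ∑ u, c u * ((eps fun i => Fin.append v w (Fin.cast h.symm i)) * mono v u) =
        (eps fun i => Fin.append v w (Fin.cast h.symm i)) * ((Nat.factorial p : ℝ) * c v) := by
      rw [← hc.sum_mono_mul, Finset.mul_sum]
      exact Finset.sum_congr rfl fun u _ => by ring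
    rw [h2] at h1
    have h3 := (mul_eq_zero.mp h1).resolve_left (one_div_ne_zero hp)
    exact (mul_eq_zero.mp ((mul_eq_zero.mp h3).resolve_left he)).resolve_left hp
  · exact hc.1 v hv

theorem wedge_eq_zero_iff (h : p + q + r = 7) (a : (Fin p → Fin 7) → ℝ)
    (b : (Fin q → Fin 7) → ℝ) : wedge a b = 0 ↔ ∀ w : Fin r → Fin 7, hstar h (wedge a b) w = 0 :=
  ⟨fun h0 w => by simp [h0, hstar], (wedge_isForm a b).eq_zero_of_hstar h⟩

end Alternating

section IntegerComponents

/-- The sign of `b - a`. -/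
def ordSign (a b : Fin 7) : ℤ := if a.1 < b.1 then 1 else if a.1 = b.1 then 0 else -1

theorem ordSign_swap (a b : Fin 7) : ordSign b a = -ordSign a b := by
  unfold ordSign
  split_ifs <;> omega

/-- The Levi-Civita symbol with integer values. -/
def epsInt (a b c d e f g : Fin 7) : ℤ :=
  ordSign a b * ordSign a c * ordSign a d * ordSign a e * ordSign a f * ordSign a g *
  (ordSign b c * ordSign b d * ordSign b e * ordSign b f * ordSign b g) *
  (ordSign c d * ordSign c e * ordSign c f * ordSign c g) *
  (ordSign d e * ordSign d f * ordSign d g) * (ordSign e f * ordSign e g) * ordSign f g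

theorem eps_eq_prod (v : Fin 7 → Fin 7) :
    eps v = ((∏ i, ∏ j ∈ Finset.Ioi i, ordSign (v i) (v j) : ℤ) : ℝ) := by
  by_cases h : Function.Injective v
  · have hb := Finite.injective_iff_bijective.mp h
    rw [eps, dif_pos hb, Equiv.Perm.sign_eq_prod_prod_Ioi]
    simp only [Units.coe_prod]
    congr 1
    refine Finset.prod_congr rfl fun i _ => Finset.prod_congr rfl fun j hj => ?_
    have hne : (v i).1 ≠ (v j).1 := fun e => (Finset.mem_Ioi.mp hj).ne (h (Fin.ext e))
    simp only [Equiv.ofBijective_apply, Fin.lt_def, ordSign, if_neg hne]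
    split_ifs <;> rfl
  · rw [eps, dif_neg fun hb => h hb.1]
    simp only [Function.Injective, not_forall] at h
    obtain ⟨i, j, hij, hne⟩ := h
    wlog hlt : i < j generalizing i j
    · exact this j i hij.symm (Ne.symm hne) (lt_of_le_of_ne (not_lt.mp hlt) (Ne.symm hne))
    rw [Finset.prod_eq_zero (Finset.mem_univ i), Int.cast_zero]
    exact Finset.prod_eq_zero (Finset.mem_Ioi.mpr hlt) (by simp [ordSign, hij])

theorem eps_eq_epsInt (v : Fin 7 → Fin 7) :
    eps v = (epsInt (v 0) (v 1) (v 2) (v 3) (v 4) (v 5) (v 6) : ℝ) := by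
  have hf (i : Fin 7) : Finset.Ioi i = Finset.univ.filter (i < ·) := by ext; simp
  rw [eps_eq_prod]
  congr 1
  simp only [hf, Finset.prod_filter, Fin.prod_univ_seven]
  simp [epsInt, mul_assoc]

/-- The components of `ω`: nonzero exactly on the permutations of `(i, i + 1, i + 3)`. -/
def omegaInt (i j k : Fin 7) : ℤ :=
  let c := 7 * ((j.1 + (7 - i.1)) % 7) + (k.1 + (7 - i.1)) % 7
  if c = 10 ∨ c = 20 ∨ c = 33 then 1 else if c = 22 ∨ c = 44 ∨ c = 39 then -1 else 0

/-- The components of `⋆ω`, by the contraction identity for the associative 3-form. -/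
def psiInt (m i j k : Fin 7) : ℤ :=
  (∑ p, omegaInt m i p * omegaInt p j k) - (if m = j ∧ i = k then 1 else 0) +
    (if m = k ∧ i = j then 1 else 0)

theorem omegaInt_eq_det : ∀ i j k, omegaInt i j k =
    let m (x y : Fin 7) : ℤ := if x = y then 1 else 0
    let d (a b c : Fin 7) : ℤ :=
      m a i * m b j * m c k - m a i * m b k * m c j - m a j * m b i * m c k +
        m a j * m b k * m c i + m a k * m b i * m c j - m a k * m b j * m c i
    d 0 1 3 + d 1 2 4 + d 2 3 5 + d 3 4 6 + d 4 5 0 + d 5 6 1 + d 6 0 2 := by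
  decide +kernel

theorem epsInt_Phi : ∀ i j k,
    -epsInt i j k 2 4 5 6 - epsInt i j k 3 5 6 0 - epsInt i j k 4 6 0 1 - epsInt i j k 5 0 1 2 -
      epsInt i j k 6 1 2 3 - epsInt i j k 0 2 3 4 - epsInt i j k 1 3 4 5 = omegaInt i j k := by
  decide +kernel

theorem epsInt_omega : ∀ m i j k,
    epsInt m 0 1 3 i j k + epsInt m 1 2 4 i j k + epsInt m 2 3 5 i j k + epsInt m 3 4 6 i j k +
      epsInt m 4 5 0 i j k + epsInt m 5 6 1 i j k + epsInt m 6 0 2 i j k = psiInt m i j k := by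
  decide +kernel

theorem sum_omegaInt_mul_omegaInt : ∑ i, ∑ j, ∑ k, omegaInt i j k * omegaInt i j k = 42 := by
  decide +kernel

theorem sum_omegaInt_mul_psiInt : ∀ m,
    ∑ i, ∑ j, ∑ k, omegaInt i j k * psiInt m i j k = 0 := by
  decide +kernel

theorem sum_psiInt_mul_psiInt : ∀ m n,
    ∑ i, ∑ j, ∑ k, psiInt m i j k * psiInt n i j k = if m = n then 24 else 0 := by
  decide +kernel

theorem epsInt_reverse_blocks (m a b c i j k : Fin 7) :
    epsInt i j k a b c m = -epsInt m a b c i j k := by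
  simp only [epsInt, ordSign_swap m, ordSign_swap a i, ordSign_swap a j, ordSign_swap a k,
    ordSign_swap b i, ordSign_swap b j, ordSign_swap b k, ordSign_swap c i, ordSign_swap c j,
    ordSign_swap c k]
  ring

end IntegerComponents

section ThreeForms

theorem omega_eq_omegaInt (v : Fin 3 → Fin 7) : ω v = (omegaInt (v 0) (v 1) (v 2) : ℝ) := by
  rw [omegaInt_eq_det]
  simp only [ω, mono, Pi.add_apply, Matrix.det_fin_three, Matrix.of_apply, Int.cast_add,
    Int.cast_sub, Int.cast_mul, Int.cast_ite, Int.cast_one, Int.cast_zero]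
  rfl

theorem isForm_omega : IsForm ω := by
  unfold ω
  exact ((((((isForm_mono _).add (isForm_mono _)).add (isForm_mono _)).add (isForm_mono _)).add
    (isForm_mono _)).add (isForm_mono _)).add (isForm_mono _)

theorem IsForm.sum_omega_mul {g : (Fin 3 → Fin 7) → ℝ} (hg : IsForm g) :
    ∑ v, ω v * g v = 6 * (g ![0, 1, 3] + g ![1, 2, 4] + g ![2, 3, 5] + g ![3, 4, 6] +
      g ![4, 5, 0] + g ![5, 6, 1] + g ![6, 0, 2]) := by
  simp only [ω, Pi.add_apply, add_mul, Finset.sum_add_distrib, hg.sum_mono_mul]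
  norm_num [Nat.factorial]
  ring

theorem IsForm.sum_Phi_mul {g : (Fin 4 → Fin 7) → ℝ} (hg : IsForm g) :
    ∑ v, Φ v * g v = 24 * (-g ![2, 4, 5, 6] - g ![3, 5, 6, 0] - g ![4, 6, 0, 1] -
      g ![5, 0, 1, 2] - g ![6, 1, 2, 3] - g ![0, 2, 3, 4] - g ![1, 3, 4, 5]) := by
  simp only [Φ, Pi.sub_apply, Pi.neg_apply, sub_mul, neg_mul, Finset.sum_sub_distrib,
    Finset.sum_neg_distrib, hg.sum_mono_mul]
  norm_num [Nat.factorial]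
  ring

/-- The 3-form `⋆(e_m ∧ ω)`, where `m = x 0`. -/
noncomputable def starWedgeOmega (x : Fin 1 → Fin 7) (w : Fin 3 → Fin 7) : ℝ :=
  psiInt (x 0) (w 0) (w 1) (w 2)

theorem hstar_wedge_omega (β : (Fin 1 → Fin 7) → ℝ) :
    hstar (p := 4) (q := 3) rfl (wedge β ω) = ∑ x, β x • starWedgeOmega x := by
  funext w
  refine (hstar_wedge (p := 1) (q := 3) (r := 3) rfl β ω w).trans ?_
  rw [Finset.sum_apply, Finset.mul_sum]
  refine Finset.sum_congr rfl fun x _ => ?_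
  rw [(isForm_eps_append_append (p := 1) (q := 3) rfl x w).sum_omega_mul, Pi.smul_apply,
    starWedgeOmega, ← epsInt_omega]
  have e (y : Fin 3 → Fin 7) :
      (eps fun i => Fin.append (Fin.append x y) w (Fin.cast rfl i)) =
        (epsInt (x 0) (y 0) (y 1) (y 2) (w 0) (w 1) (w 2) : ℝ) := eps_eq_epsInt _
  simp only [e]
  simp [Nat.factorial]
  ring

theorem wedge_omega_eq_zero_iff (γ : (Fin 3 → Fin 7) → ℝ) :
    wedge γ ω = 0 ↔ ∀ x, ∑ w, γ w * starWedgeOmega x w = 0 := by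
  rw [wedge_eq_zero_iff (r := 1) rfl]
  refine forall_congr' fun x => ?_
  have (w : Fin 3 → Fin 7) : ∑ y, ω y * (eps fun i =>
      Fin.append (Fin.append w y) x (Fin.cast rfl i)) = -6 * starWedgeOmega x w := by
    rw [(isForm_eps_append_append (p := 3) (q := 3) rfl w x).sum_omega_mul,
      starWedgeOmega, ← epsInt_omega]
    have e (y : Fin 3 → Fin 7) : (eps fun i => Fin.append (Fin.append w y) x (Fin.cast rfl i)) =
        -(epsInt (x 0) (y 0) (y 1) (y 2) (w 0) (w 1) (w 2) : ℝ) := by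
      rw [← Int.cast_neg, ← epsInt_reverse_blocks]
      exact eps_eq_epsInt _
    simp only [e]
    simp
    ring
  rw [hstar_wedge]
  simp only [this, mul_left_comm _ (-6 : ℝ), ← Finset.mul_sum]
  simp [Nat.factorial]

theorem wedge_Phi_eq_zero_iff (γ : (Fin 3 → Fin 7) → ℝ) :
    wedge γ Φ = 0 ↔ ∑ w, γ w * ω w = 0 := by
  have (x : Fin 0 → Fin 7) (w : Fin 3 → Fin 7) : ∑ y, Φ y * (eps fun i =>
      Fin.append (Fin.append w y) x (Fin.cast rfl i)) = 24 * ω w := by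
    rw [(isForm_eps_append_append (p := 3) (q := 4) rfl w x).sum_Phi_mul,
      omega_eq_omegaInt, ← epsInt_Phi]
    have e (y : Fin 4 → Fin 7) : (eps fun i => Fin.append (Fin.append w y) x (Fin.cast rfl i)) =
        (epsInt (w 0) (w 1) (w 2) (y 0) (y 1) (y 2) (y 3) : ℝ) := eps_eq_epsInt _
    simp only [e]
    simp
  rw [wedge_eq_zero_iff (r := 0) rfl]
  simp only [hstar_wedge, this, mul_left_comm _ (24 : ℝ), ← Finset.mul_sum]
  simp [Nat.factorial]

theorem sum_triples (f : Fin 7 → Fin 7 → Fin 7 → ℤ) :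
    ∑ w : Fin 3 → Fin 7, (f (w 0) (w 1) (w 2) : ℝ) = ((∑ i, ∑ j, ∑ k, f i j k : ℤ) : ℝ) := by
  have e : ∑ i, ∑ j, ∑ k, f i j k = ∑ t : Fin 7 × Fin 7 × Fin 7, f t.1 t.2.1 t.2.2 := by
    simp only [Fintype.sum_prod_type]
  rw [e]
  push_cast
  refine (Fintype.sum_bijective (fun t : Fin 7 × Fin 7 × Fin 7 => ![t.1, t.2.1, t.2.2])
    ⟨fun s t h => ?_, fun w => ⟨(w 0, w 1, w 2), ?_⟩⟩ _ _ fun t => by simp).symm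
  · have h0 := congrFun h 0
    have h1 := congrFun h 1
    have h2 := congrFun h 2
    exact Prod.ext h0 (Prod.ext h1 h2)
  · funext i
    fin_cases i <;> rfl

theorem sum_omega_mul_omega : ∑ w, ω w * ω w = 42 := by
  simp only [omega_eq_omegaInt, ← Int.cast_mul]
  rw [sum_triples fun i j k => omegaInt i j k * omegaInt i j k, sum_omegaInt_mul_omegaInt]
  norm_num

theorem sum_omega_mul_starWedgeOmega (x : Fin 1 → Fin 7) : ∑ w, ω w * starWedgeOmega x w = 0 := by
  simp only [omega_eq_omegaInt, starWedgeOmega, ← Int.cast_mul]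
  rw [sum_triples fun i j k => omegaInt i j k * psiInt (x 0) i j k, sum_omegaInt_mul_psiInt,
    Int.cast_zero]

theorem sum_starWedgeOmega_mul_starWedgeOmega (x y : Fin 1 → Fin 7) :
    ∑ w, starWedgeOmega x w * starWedgeOmega y w = if x = y then 24 else 0 := by
  simp only [starWedgeOmega, ← Int.cast_mul]
  rw [sum_triples fun i j k => psiInt (x 0) i j k * psiInt (y 0) i j k, sum_psiInt_mul_psiInt]
  have : x 0 = y 0 ↔ x = y := by simp [funext_iff]
  simp [this]

theorem sum_decomposition_mul_omega (t : ℝ) (β : (Fin 1 → Fin 7) → ℝ)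
    (γ : (Fin 3 → Fin 7) → ℝ) :
    ∑ w, (t • ω + ∑ x, β x • starWedgeOmega x + γ) w * ω w = 42 * t + ∑ w, γ w * ω w := by
  have h : ∑ w, (∑ x, β x • starWedgeOmega x) w * ω w = 0 := by
    simp only [Finset.sum_apply, Finset.sum_mul]
    rw [Finset.sum_comm]
    refine Finset.sum_eq_zero fun x _ => ?_
    rw [← mul_zero (β x), ← sum_omega_mul_starWedgeOmega x, Finset.mul_sum]
    exact Finset.sum_congr rfl fun w _ => by simp only [Pi.smul_apply, smul_eq_mul]; ring
  have h' : ∑ w, (t • ω) w * ω w = 42 * t := by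
    rw [← sum_omega_mul_omega, Finset.sum_mul]
    exact Finset.sum_congr rfl fun w _ => by simp only [Pi.smul_apply, smul_eq_mul]; ring
  simp only [Pi.add_apply, add_mul, Finset.sum_add_distrib] at h h' ⊢
  rw [h, h', add_zero]

theorem sum_decomposition_mul_starWedgeOmega (t : ℝ) (β : (Fin 1 → Fin 7) → ℝ)
    (γ : (Fin 3 → Fin 7) → ℝ) (y : Fin 1 → Fin 7) :
    ∑ w, (t • ω + ∑ x, β x • starWedgeOmega x + γ) w * starWedgeOmega y w =
      24 * β y + ∑ w, γ w * starWedgeOmega y w := by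
  have h : ∑ w, (∑ x, β x • starWedgeOmega x) w * starWedgeOmega y w = 24 * β y := by
    simp only [Finset.sum_apply, Finset.sum_mul]
    rw [Finset.sum_comm]
    simp only [Pi.smul_apply, smul_eq_mul, mul_assoc, ← Finset.mul_sum,
      sum_starWedgeOmega_mul_starWedgeOmega]
    simp [mul_comm]
  have h' : ∑ w, (t • ω) w * starWedgeOmega y w = 0 := by
    simp only [Pi.smul_apply, smul_eq_mul, mul_assoc, ← Finset.mul_sum,
      sum_omega_mul_starWedgeOmega, mul_zero]
  simp only [Pi.add_apply, add_mul, Finset.sum_add_distrib] at h h' ⊢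
  rw [h, h', zero_add]

end ThreeForms

/-- every 3-form σ is uniquely σ = t·ω + ⋆(β∧ω) + γ with γ∧ω = 0 and γ∧Φ = 0. -/
theorem three_form_decomposition (s : (Fin 3 → Fin 7) → ℝ) (hs : IsForm s) :
    ∃! d : ℝ × ((Fin 1 → Fin 7) → ℝ) × ((Fin 3 → Fin 7) → ℝ),
      IsForm d.2.2 ∧
      s = d.1 • ω + hstar (p := 4) (q := 3) rfl (wedge d.2.1 ω) + d.2.2 ∧
      wedge d.2.2 ω = 0 ∧ wedge d.2.2 Φ = 0 := by
  let t : ℝ := (∑ w, s w * ω w) / 42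
  let β : (Fin 1 → Fin 7) → ℝ := fun x => (∑ w, s w * starWedgeOmega x w) / 24
  let γ : (Fin 3 → Fin 7) → ℝ := s - t • ω - hstar (p := 4) (q := 3) rfl (wedge β ω)
  have hsum : s = t • ω + hstar (p := 4) (q := 3) rfl (wedge β ω) + γ := by
    simp only [γ]
    abel
  refine ⟨(t, β, γ), ⟨(hs.sub (isForm_omega.smul t)).sub (isForm_hstar _ _), hsum, ?_, ?_⟩, ?_⟩
  · refine (wedge_omega_eq_zero_iff γ).mpr fun y => ?_
    have h := sum_decomposition_mul_starWedgeOmega t β γ y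
    rw [← hstar_wedge_omega, ← hsum] at h
    simp only [β] at h
    linarith
  · refine (wedge_Phi_eq_zero_iff γ).mpr ?_
    have h := sum_decomposition_mul_omega t β γ
    rw [← hstar_wedge_omega, ← hsum] at h
    simp only [t] at h
    linarith
  · rintro ⟨t', β', γ'⟩ ⟨-, hsum', hω, hΦ⟩
    simp only at hsum' hω hΦ
    have ht : t' = t := by
      have h := sum_decomposition_mul_omega t' β' γ'
      rw [← hstar_wedge_omega, ← hsum', (wedge_Phi_eq_zero_iff γ').mp hΦ] at h
      simp only [t]
      linarith
    have hβ : β' = β := by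
      funext y
      have h := sum_decomposition_mul_starWedgeOmega t' β' γ' y
      rw [← hstar_wedge_omega, ← hsum', (wedge_omega_eq_zero_iff γ').mp hω y] at h
      simp only [β]
      linarith
    subst ht hβ
    rw [add_left_cancel (hsum'.symm.trans hsum)]
end
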